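/- Let G be a cube-free median graph and z a vertex of G. For each fiber F(x) of the star St(z), the total boundary ∂*F(x) is quasigated: every vertex u of G not in ∂*F(x) has at most two imprints on ∂*F(x). -/

import Mathlib

open SimpleGraph Set

/-- The metric interval `I(u,v)` in a graph `G`. -/
def gInterval {V : Type*} (G : SimpleGraph V) (u v : V) : Set V :=
  {w | G.dist u w + G.dist w v = G.dist u v}

/-- A median graph: a connected graph in which every triplet of vertices has a
unique median, i.e. a unique vertex in `I(x,y) ∩ I(y,z) ∩ I(z,x)`. -/
def MedianGraph {V : Type*} (G : SimpleGraph V) : Prop :=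
  G.Connected ∧ ∀ x y z : V,
    ∃! m : V, m ∈ gInterval G x y ∧ m ∈ gInterval G y z ∧ m ∈ gInterval G z x

/-- `G` contains an induced `d`-dimensional hypercube all of whose vertices lie in `S`. -/
def HasCubeIn {V : Type*} (G : SimpleGraph V) (d : ℕ) (S : Set V) : Prop :=
  ∃ f : Finset (Fin d) → V, Function.Injective f ∧ (∀ A, f A ∈ S) ∧
    ∀ A B : Finset (Fin d), G.Adj (f A) (f B) ↔ (symmDiff A B).card = 1

/-- `G` contains an induced `d`-dimensional hypercube `Q_d`. -/
def HasInducedCube {V : Type*} (G : SimpleGraph V) (d : ℕ) : Prop :=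
  HasCubeIn G d Set.univ

/-- A cube-free (median) graph: no induced 3-dimensional hypercube. -/
def CubeFree {V : Type*} (G : SimpleGraph V) : Prop :=
  ¬ HasInducedCube G 3

/-- `g` is a gate of `v` in the set `S`. -/
def IsGate {V : Type*} (G : SimpleGraph V) (S : Set V) (v g : V) : Prop :=
  g ∈ S ∧ ∀ u ∈ S, G.dist v u = G.dist v g + G.dist g u

/-- A set of vertices is gated if every vertex has a gate in it. -/
def Gated {V : Type*} (G : SimpleGraph V) (S : Set V) : Prop :=
  ∀ v : V, ∃ g : V, IsGate G S v g

/-- A set of vertices is convex if it contains the interval between any two of its members. -/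
def GConvex {V : Type*} (G : SimpleGraph V) (S : Set V) : Prop :=
  ∀ u ∈ S, ∀ v ∈ S, gInterval G u v ⊆ S

/-- The star `St(z)`: the set of vertices lying in some induced hypercube of `G`
containing `z`. -/
def gStar {V : Type*} (G : SimpleGraph V) (z : V) : Set V :=
  {v | ∃ (d : ℕ) (f : Finset (Fin d) → V), Function.Injective f ∧
      (∀ A B : Finset (Fin d), G.Adj (f A) (f B) ↔ (symmDiff A B).card = 1) ∧
      (∃ A, f A = z) ∧ (∃ A, f A = v)}

/-- The fiber `F(x)` of `x` with respect to a (gated) set `H`: all vertices having `x`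
as their gate in `H`. -/
def fiber {V : Type*} (G : SimpleGraph V) (H : Set V) (x : V) : Set V :=
  {v | IsGate G H v x}

/-- Two fibers are neighboring when an edge of `G` joins them. -/
def Neighboring {V : Type*} (G : SimpleGraph V) (H : Set V) (x y : V) : Prop :=
  ∃ a ∈ fiber G H x, ∃ b ∈ fiber G H y, G.Adj a b

/-- The boundary `∂_y F(x)`: vertices of `F(x)` having a neighbor in `F(y)`. -/
def bdry {V : Type*} (G : SimpleGraph V) (H : Set V) (x y : V) : Set V :=
  {a | a ∈ fiber G H x ∧ ∃ b ∈ fiber G H y, G.Adj a b}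

/-- The total boundary `∂*F(x)`: union of the boundaries `∂_y F(x)` over all `y ∈ H`
adjacent to `x`. -/
def totalBdry {V : Type*} (G : SimpleGraph V) (H : Set V) (x : V) : Set V :=
  ⋃ (y : V) (_ : y ∈ H ∧ G.Adj x y), bdry G H x y

/-- The imprint set of `u` on `A`. -/
def imprints {V : Type*} (G : SimpleGraph V) (u : V) (A : Set V) : Set V :=
  {a ∈ A | gInterval G u a ∩ A = {a}}

/-- The halfspace `W(u,v)` associated with an edge `uv`. -/
def halfspaceW {V : Type*} (G : SimpleGraph V) (u v : V) : Set V :=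
  {z | G.dist z u < G.dist z v}


namespace QG

variable {V : Type*} {G : SimpleGraph V}

theorem exMed (hG : MedianGraph G) (a b c : V) :
    ∃ m, G.dist a m + G.dist m b = G.dist a b ∧ G.dist b m + G.dist m c = G.dist b c ∧
      G.dist c m + G.dist m a = G.dist c a := by
  obtain ⟨m, hm, -⟩ := hG.2 a b c
  exact ⟨m, hm⟩

theorem uniqMed (hG : MedianGraph G) {a b c m n : V}
    (h1 : G.dist a m + G.dist m b = G.dist a b) (h2 : G.dist b m + G.dist m c = G.dist b c)
    (h3 : G.dist c m + G.dist m a = G.dist c a)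
    (h1' : G.dist a n + G.dist n b = G.dist a b) (h2' : G.dist b n + G.dist n c = G.dist b c)
    (h3' : G.dist c n + G.dist n a = G.dist c a) : m = n :=
  (hG.2 a b c).unique ⟨h1, h2, h3⟩ ⟨h1', h2', h3'⟩

theorem cm (a b : V) : G.dist a b = G.dist b a := SimpleGraph.dist_comm

theorem tr (hG : MedianGraph G) (a b c : V) : G.dist a c ≤ G.dist a b + G.dist b c :=
  hG.1.dist_triangle

theorem d0 (hG : MedianGraph G) {a b : V} (h : G.dist a b = 0) : a = b :=
  hG.1.dist_eq_zero_iff.1 h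

/-- Median of `a, b, s` is the gate of `s` in `I(a,b)`. -/
theorem gateL (hG : MedianGraph G) {a b s q m : V}
    (h1 : G.dist a q + G.dist q b = G.dist a b) (h2 : G.dist b q + G.dist q s = G.dist b s)
    (h3 : G.dist s q + G.dist q a = G.dist s a)
    (hm : G.dist a m + G.dist m b = G.dist a b) :
    G.dist m q + G.dist q s = G.dist m s := by
  obtain ⟨p, p1, p2, p3⟩ := exMed hG a m s
  obtain ⟨r, r1, r2, r3⟩ := exMed hG p b s
  have e : r = q := by
    refine uniqMed hG ?_ r2 ?_ h1 h2 h3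
    · have := tr hG a r b
      have := tr hG a p r
      have := tr hG a p b
      have := tr hG p m b
      omega
    · have := tr hG s r a
      have := tr hG r p a
      omega
  subst e
  have := tr hG m r s
  have := tr hG m p r
  have := cm (G := G) p r
  have := cm (G := G) s r
  have := cm (G := G) s p
  omega

/-- Meet property. -/
theorem meetL (hG : MedianGraph G) {j s x q w : V}
    (h1 : G.dist j q + G.dist q s = G.dist j s) (h2 : G.dist s q + G.dist q x = G.dist s x)
    (h3 : G.dist x q + G.dist q j = G.dist x j)
    (hj : G.dist x w + G.dist w j = G.dist x j) (hs : G.dist x w + G.dist w s = G.dist x s) :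
    G.dist x w + G.dist w q = G.dist x q := by
  obtain ⟨r, r1, r2, r3⟩ := exMed hG j s w
  have := cm (G := G) s x
  have := cm (G := G) s w
  have := cm (G := G) w x
  have := cm (G := G) w r
  have := cm (G := G) s r
  have := cm (G := G) x r
  have := tr hG x w r
  have e : r = q := by
    refine uniqMed hG r1 ?_ ?_ h1 h2 h3
    · have := tr hG s r x
      omega
    · have := tr hG x r j
      omega
  subst e
  have := tr hG x r j
  omega

theorem convL (hG : MedianGraph G) {a b m x w : V}
    (ha : G.dist a x + G.dist x w = G.dist a w) (hb : G.dist b x + G.dist x w = G.dist b w)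
    (hm : G.dist a m + G.dist m b = G.dist a b) :
    G.dist m x + G.dist x w = G.dist m w := by
  obtain ⟨q, q1, q2, q3⟩ := exMed hG a b w
  have h1 := gateL hG q1 q2 q3 hm
  have h2 := meetL hG q1 q2 q3 (w := x)
    (by rw [cm w x, cm x a, cm w a]; omega) (by rw [cm w x, cm x b, cm w b]; omega)
  have := tr hG m x w
  have := tr hG m q x
  have := cm (G := G) w x
  have := cm (G := G) q x
  have := cm (G := G) w q
  omega

theorem bip (hG : MedianGraph G) {a b : V} (h : G.Adj a b) (m : V) :
    G.dist m a = G.dist m b + 1 ∨ G.dist m b = G.dist m a + 1 := by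
  obtain ⟨q, q1, q2, q3⟩ := exMed hG m a b
  have h1 : G.dist a b = 1 := SimpleGraph.dist_eq_one_iff_adj.2 h
  have : G.dist a q = 0 ∨ G.dist q b = 0 := by omega
  rcases this with h | h
  · have := d0 hG h
    subst this
    right
    rw [cm m b]; rw [cm b a, cm a m] at q3; omega
  · have := d0 hG h
    subst this
    left
    rw [cm a q] at h1; omega

theorem mkCube (hG : MedianGraph G) (g : Bool → Bool → Bool → V)
    (h1 : ∀ p q, G.Adj (g true p q) (g false p q))
    (h2 : ∀ p q, G.Adj (g p true q) (g p false q))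
    (h3 : ∀ p q, G.Adj (g p q true) (g p q false))
    (h4 : ∀ p q r, ¬ G.dist (g p q r) (g (!p) (!q) (!r)) ≤ 1) : HasInducedCube G 3 := by
  have a1 : ∀ p q r, G.dist (g p q r) (g (!p) q r) = 1 := by
    intro p q r
    cases p
    · exact SimpleGraph.dist_eq_one_iff_adj.2 (h1 q r).symm
    · exact SimpleGraph.dist_eq_one_iff_adj.2 (h1 q r)
  have a2 : ∀ p q r, G.dist (g p q r) (g p (!q) r) = 1 := by
    intro p q r
    cases q
    · exact SimpleGraph.dist_eq_one_iff_adj.2 (h2 p r).symm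
    · exact SimpleGraph.dist_eq_one_iff_adj.2 (h2 p r)
  have a3 : ∀ p q r, G.dist (g p q r) (g p q (!r)) = 1 := by
    intro p q r
    cases r
    · exact SimpleGraph.dist_eq_one_iff_adj.2 (h3 p q).symm
    · exact SimpleGraph.dist_eq_one_iff_adj.2 (h3 p q)
  have b1 : ∀ p q r, G.dist (g p q r) (g p (!q) (!r)) = 2 := by
    intro p q r
    have := tr hG (g p q r) (g p (!q) r) (g p (!q) (!r))
    have := a2 p q r
    have := a3 p (!q) r
    have := a1 p (!q) (!r)
    have := tr hG (g p q r) (g p (!q) (!r)) (g (!p) (!q) (!r))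
    have h5 := h4 p q r
    have := bip hG (SimpleGraph.dist_eq_one_iff_adj.1 (a3 p (!q) r)) (g p q r)
    omega
  have b2 : ∀ p q r, G.dist (g p q r) (g (!p) q (!r)) = 2 := by
    intro p q r
    have := tr hG (g p q r) (g (!p) q r) (g (!p) q (!r))
    have := a1 p q r
    have := a3 (!p) q r
    have := a2 (!p) q (!r)
    have := tr hG (g p q r) (g (!p) q (!r)) (g (!p) (!q) (!r))
    have h5 := h4 p q r
    have := bip hG (SimpleGraph.dist_eq_one_iff_adj.1 (a3 (!p) q r)) (g p q r)
    omega
  have b3 : ∀ p q r, G.dist (g p q r) (g (!p) (!q) r) = 2 := by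
    intro p q r
    have := tr hG (g p q r) (g (!p) q r) (g (!p) (!q) r)
    have := a1 p q r
    have := a2 (!p) q r
    have := a3 (!p) (!q) r
    have := tr hG (g p q r) (g (!p) (!q) r) (g (!p) (!q) (!r))
    have h5 := h4 p q r
    have := bip hG (SimpleGraph.dist_eq_one_iff_adj.1 (a2 (!p) q r)) (g p q r)
    omega
  have c : ∀ p q r p' q' r', (G.dist (g p q r) (g p' q' r') = 0 → p = p' ∧ q = q' ∧ r = r') ∧
      (G.dist (g p q r) (g p' q' r') = 1 ↔ (xor p p').toNat + (xor q q').toNat + (xor r r').toNat = 1) := by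
    intro p q r p' q' r'
    have e1 := a1 p q r
    have e2 := a2 p q r
    have e3 := a3 p q r
    have f1 := b1 p q r
    have f2 := b2 p q r
    have f3 := b3 p q r
    have f4 := h4 p q r
    have f5 : G.dist (g p q r) (g (!p) (!q) (!r)) ≠ 0 ∧ G.dist (g p q r) (g (!p) (!q) (!r)) ≠ 1 := by omega
    have key : ∀ b b' : Bool, b' = b ∨ b' = !b := by decide
    rcases key p p' with rfl | rfl <;> rcases key q q' with rfl | rfl <;>
      rcases key r r' with rfl | rfl <;> simp only [SimpleGraph.dist_self, e1, e2, e3, f1, f2, f3, f5.1, f5.2] <;> simp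
  refine ⟨fun A => g (decide (0 ∈ A)) (decide (1 ∈ A)) (decide (2 ∈ A)), ?_, fun _ => trivial, ?_⟩
  · intro A B hAB
    have h := (c (decide (0 ∈ A)) (decide (1 ∈ A)) (decide (2 ∈ A))
      (decide (0 ∈ B)) (decide (1 ∈ B)) (decide (2 ∈ B))).1
      (by simp only at hAB; rw [hAB]; exact SimpleGraph.dist_self)
    simp only [decide_eq_decide] at h
    ext i
    fin_cases i
    · exact h.1
    · exact h.2.1
    · exact h.2.2
  · intro A B
    rw [← SimpleGraph.dist_eq_one_iff_adj, (c _ _ _ _ _ _).2]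
    revert A B
    decide

/-- Downward cube property. -/
theorem downCube (hG : MedianGraph G) {x t s1 s2 s3 : V}
    (h1 : G.dist t s1 = 1) (h2 : G.dist t s2 = 1) (h3 : G.dist t s3 = 1)
    (k1 : G.dist x s1 + 1 = G.dist x t) (k2 : G.dist x s2 + 1 = G.dist x t)
    (k3 : G.dist x s3 + 1 = G.dist x t)
    (n12 : s1 ≠ s2) (n13 : s1 ≠ s3) (n23 : s2 ≠ s3) : HasInducedCube G 3 := by
  have quad : ∀ {t s s' : V}, G.dist t s = 1 → G.dist t s' = 1 → G.dist x s + 1 = G.dist x t →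
      G.dist x s' + 1 = G.dist x t → s ≠ s' →
      ∃ c, G.dist s c = 1 ∧ G.dist s' c = 1 ∧ G.dist x c + 2 = G.dist x t ∧ G.dist s s' = 2 ∧
        (∀ w, G.dist x w + G.dist w s = G.dist x s → G.dist x w + G.dist w s' = G.dist x s' →
          G.dist x w + G.dist w c = G.dist x c) := by
    intro t s s' h h' k k' n
    obtain ⟨c, c1, c2, c3⟩ := exMed hG s s' x
    have := tr hG s t s'
    have := cm (G := G) s t
    have := cm (G := G) s x
    have := cm (G := G) s' x
    have := cm (G := G) c x
    have := cm (G := G) c s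
    have := cm (G := G) c s'
    have n0 : G.dist s s' ≠ 0 := fun e => n (d0 hG e)
    have := bip hG (SimpleGraph.dist_eq_one_iff_adj.1 h') s
    refine ⟨c, by omega, by omega, by omega, by omega, fun w w1 w2 => meetL hG c1 c2 c3 w1 w2⟩
  obtain ⟨c12, a1, a2, a3, a4, a5⟩ := quad h1 h2 k1 k2 n12
  obtain ⟨c13, b1, b2, b3, b4, b5⟩ := quad h1 h3 k1 k3 n13
  obtain ⟨c23, d1, d2, d3, d4, d5⟩ := quad h2 h3 k2 k3 n23
  have noK : ∀ c, G.dist s1 c = 1 → G.dist s2 c = 1 → G.dist s3 c = 1 → G.dist x c + 2 = G.dist x t →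
      False := by
    intro c e1 e2 e3 e4
    have : c = t := by
      apply uniqMed hG (a := s1) (b := s2) (c := s3) <;>
      simp only [cm s3 s1, cm c s1, cm c s2, cm c s3, cm s1 t, cm s2 t, cm s3 t, *]
    subst this
    omega
  have m1 : c12 ≠ c13 := by
    rintro rfl
    exact noK _ a1 a2 b2 a3
  obtain ⟨e, e1, e2, e3, e4, e5⟩ := quad a1 b1 (by omega) (by omega) m1
  have e6 : G.dist c23 e = 1 := by
    have := tr hG x e s2
    have := tr hG x e s3
    have := tr hG e c12 s2
    have := tr hG e c13 s3
    have := cm (G := G) e c12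
    have := cm (G := G) e c13
    have := cm (G := G) s2 c12
    have := cm (G := G) s3 c13
    have := cm (G := G) e c23
    have := d5 e (by omega) (by omega)
    omega
  have adj : ∀ {a b}, G.dist a b = 1 → G.Adj a b := SimpleGraph.dist_eq_one_iff_adj.1
  have t1 := tr hG x e t
  have p1 : ¬ G.dist s1 c23 ≤ 1 := by
    intro h
    have := bip hG (adj d1) s1
    have : G.dist s1 c23 = 1 := by omega
    exact noK _ this d1 d2 d3
  have p2 : ¬ G.dist s2 c13 ≤ 1 := by
    intro h
    have := bip hG (adj b1) s2
    have := cm (G := G) s1 s2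
    have : G.dist s2 c13 = 1 := by omega
    exact noK _ b1 this b2 b3
  have p3 : ¬ G.dist s3 c12 ≤ 1 := by
    intro h
    have := bip hG (adj a1) s3
    have := cm (G := G) s1 s3
    have : G.dist s3 c12 = 1 := by omega
    exact noK _ a1 a2 this a3
  refine mkCube hG (fun p q r => bif p then (bif q then (bif r then t else s3) else
      (bif r then s2 else c23)) else (bif q then (bif r then s1 else c13) else (bif r then c12 else e)))
      ?_ ?_ ?_ ?_
  · rintro (_ | _) (_ | _) <;> apply adj <;> simp only [cond_true, cond_false] <;> first | assumption | (rw [cm]; assumption)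
  · rintro (_ | _) (_ | _) <;> apply adj <;> simp only [cond_true, cond_false] <;> first | assumption | (rw [cm]; assumption)
  · rintro (_ | _) (_ | _) <;> apply adj <;> simp only [cond_true, cond_false] <;> first | assumption | (rw [cm]; assumption)
  · have q1 : ¬ G.dist e t ≤ 1 := by omega
    rintro (_ | _) (_ | _) (_ | _) <;> simp only [cond_true, cond_false, Bool.not_true, Bool.not_false] <;>
      first | assumption | (rw [cm]; assumption)

/-- Three pairwise incomparable elements with unique lower neighbours yield a 3-cube. -/
theorem threeIrr (hG : MedianGraph G) {x u : V} (a : Fin 3 → V)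
    (hu : ∀ i, G.dist x (a i) + G.dist (a i) u = G.dist x u)
    (hanti : ∀ i j, i ≠ j → G.dist x (a i) + G.dist (a i) (a j) ≠ G.dist x (a j))
    (huniq : ∀ i c c', G.dist (a i) c = 1 → G.dist x c + 1 = G.dist x (a i) →
      G.dist (a i) c' = 1 → G.dist x c' + 1 = G.dist x (a i) → c = c') : HasInducedCube G 3 := by
  classical
  have ex : ∃ n, ∃ t, (∀ i, G.dist x (a i) + G.dist (a i) t = G.dist x t) ∧ G.dist x t = n :=
    ⟨_, u, hu, rfl⟩
  obtain ⟨t, ht, htn⟩ := Nat.find_spec ex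
  have hmin : ∀ s, (∀ i, G.dist x (a i) + G.dist (a i) s = G.dist x s) → G.dist x t ≤ G.dist x s := by
    intro s hs
    rw [htn]
    exact Nat.find_min' ex ⟨s, hs, rfl⟩
  have step : ∀ v w : V, v ≠ w → ∃ c, G.dist v c = 1 ∧ G.dist c w + 1 = G.dist v w := by
    intro v w hvw
    obtain ⟨p, hp⟩ := hG.1.exists_walk_length_eq_dist v w
    cases p with
    | nil => exact absurd rfl hvw
    | @cons _ c _ h q =>
      have h1 := SimpleGraph.dist_eq_one_iff_adj.2 h
      refine ⟨c, h1, ?_⟩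
      have := SimpleGraph.dist_le q
      have := tr hG v c w
      simp only [SimpleGraph.Walk.length_cons] at hp
      omega
  have low : ∀ i j k, i ≠ j → i ≠ k → ¬ (G.dist (a j) t + G.dist t (a k) = G.dist (a j) (a k)) := by
    intro i j k hij hik hjk
    obtain ⟨b, b1, b2⟩ := step (a i) x (by
      intro h
      apply hanti i j hij
      rw [h]; simp)
    have hb : ∀ l, i ≠ l → G.dist (a l) b + G.dist b (a i) = G.dist (a l) (a i) := by
      intro l hl
      obtain ⟨m, m1, m2, m3⟩ := exMed hG (a i) (a l) x
      have hne : a i ≠ m := by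
        rintro rfl
        apply hanti i l hl
        rw [cm x (a i), cm (a i) (a l), cm x (a l)]; omega
      obtain ⟨c, c1, c2⟩ := step (a i) m hne
      have : c = b := by
        apply huniq i c b c1 _ b1
        · rw [cm x b, cm x (a i)]; omega
        · have := tr hG x m c
          have := tr hG x c (a i)
          have := cm (G := G) c (a i)
          have := cm (G := G) m c
          have := cm (G := G) m (a i)
          omega
      subst this
      have := tr hG (a l) m c
      have := tr hG (a l) c (a i)
      have := cm (G := G) c (a i)
      have := cm (G := G) m c
      have := cm (G := G) m (a i)
      have := cm (G := G) m (a l)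
      have := cm (G := G) (a l) (a i)
      omega
    have h := convL hG (hb j hij) (hb k hik) hjk
    have := ht i
    have := tr hG x b t
    have := cm (G := G) x b
    have := cm (G := G) x (a i)
    have := cm (G := G) b t
    have := cm (G := G) (a i) t
    have := cm (G := G) b (a i)
    omega
  have down : ∀ i j k, i ≠ j → i ≠ k → (∀ l : Fin 3, l = i ∨ l = j ∨ l = k) →
      ∃ s, G.dist t s = 1 ∧ G.dist x s + 1 = G.dist x t ∧
      G.dist x (a j) + G.dist (a j) s = G.dist x s ∧ G.dist x (a k) + G.dist (a k) s = G.dist x s ∧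
      G.dist x (a i) + G.dist (a i) s ≠ G.dist x s := by
    intro i j k hij hik hl
    obtain ⟨q, q1, q2, q3⟩ := exMed hG (a j) (a k) t
    have hne : t ≠ q := by
      rintro rfl
      exact low i j k hij hik q1
    obtain ⟨s, s1, s2⟩ := step t q hne
    have := ht j
    have := ht k
    have := tr hG x (a j) s
    have := tr hG (a j) q s
    have := tr hG x (a k) s
    have := tr hG (a k) q s
    have := tr hG x s t
    have := cm (G := G) t s
    have := cm (G := G) q s
    have := cm (G := G) q t
    have := cm (G := G) q (a j)
    have := cm (G := G) t (a j)
    have e : G.dist x s + 1 = G.dist x t := by omega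
    have ej : G.dist x (a j) + G.dist (a j) s = G.dist x s := by omega
    have ek : G.dist x (a k) + G.dist (a k) s = G.dist x s := by omega
    refine ⟨s, s1, e, ej, ek, ?_⟩
    intro ei
    have := hmin s (by
      intro l
      rcases hl l with rfl | rfl | rfl <;> assumption)
    omega
  obtain ⟨s1, p1, p2, p3, p4, p5⟩ := down 0 1 2 (by decide) (by decide) (by decide)
  obtain ⟨s2, q1, q2, q3, q4, q5⟩ := down 1 0 2 (by decide) (by decide) (by decide)
  obtain ⟨s3, r1, r2, r3, r4, r5⟩ := down 2 0 1 (by decide) (by decide) (by decide)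
  refine downCube hG p1 q1 r1 p2 q2 r2 ?_ ?_ ?_
  · rintro rfl; exact p5 q3
  · rintro rfl; exact p5 r3
  · rintro rfl; exact q5 r4

theorem fiberConv (hG : MedianGraph G) (H : Set V) (x : V) {a b m : V}
    (ha : a ∈ fiber G H x) (hb : b ∈ fiber G H x)
    (hm : G.dist a m + G.dist m b = G.dist a b) : m ∈ fiber G H x :=
  ⟨ha.1, fun w hw => (convL hG (ha.2 w hw).symm (hb.2 w hw).symm hm).symm⟩

theorem fiberDisj (hG : MedianGraph G) (H : Set V) {x y b : V} (hxy : x ≠ y)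
    (h1 : b ∈ fiber G H x) (h2 : b ∈ fiber G H y) : False := by
  have := h1.2 y h2.1
  have := h2.2 x h1.1
  exact hxy (d0 hG (by omega))

theorem fiberAcross (hG : MedianGraph G) (H : Set V) {x y m a b : V} (hxy : x ≠ y)
    (hm : m ∈ fiber G H x) (ha : a ∈ fiber G H x) (hb : b ∈ fiber G H y) (hab : G.Adj a b) :
    G.dist m b = G.dist m a + 1 := by
  rcases bip hG hab m with h | h
  · exfalso
    refine fiberDisj hG H hxy (fiberConv hG H x hm ha ?_) hb
    rw [h, cm b a, SimpleGraph.dist_eq_one_iff_adj.2 hab]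
  · exact h

theorem fiberMatch (hG : MedianGraph G) (H : Set V) {x y a b a' b' : V} (hxy : x ≠ y)
    (ha : a ∈ fiber G H x) (hb : b ∈ fiber G H y) (hab : G.Adj a b)
    (ha' : a' ∈ fiber G H x) (hb' : b' ∈ fiber G H y) (hab' : G.Adj a' b') :
    G.dist b b' = G.dist a a' := by
  have h1 := fiberAcross hG H hxy ha' ha hb hab
  have h2 := fiberAcross hG H hxy.symm hb hb' ha' hab'.symm
  rw [cm a' b] at h1
  rw [cm a' a] at h1
  omega

theorem bdryConv (hG : MedianGraph G) (H : Set V) {x y a a' m : V} (hxy : x ≠ y)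
    (ha : a ∈ bdry G H x y) (ha' : a' ∈ bdry G H x y)
    (hm : G.dist a m + G.dist m a' = G.dist a a') : m ∈ bdry G H x y := by
  obtain ⟨ha, b, hb, hab⟩ := ha
  obtain ⟨ha', b', hb', hab'⟩ := ha'
  have hmx := fiberConv hG H x ha ha' hm
  refine ⟨hmx, ?_⟩
  have h1 := fiberAcross hG H hxy hmx ha hb hab
  have h2 := fiberAcross hG H hxy hmx ha' hb' hab'
  have h3 := fiberMatch hG H hxy ha hb hab ha' hb' hab'
  obtain ⟨n, n1, n2, n3⟩ := exMed hG b b' m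
  refine ⟨n, fiberConv hG H y hb hb' n1, SimpleGraph.dist_eq_one_iff_adj.1 ?_⟩
  have := cm (G := G) m a
  have := cm (G := G) m b'
  have := cm (G := G) m n
  have := cm (G := G) n b
  have := cm (G := G) n b'
  omega

/-- The boundary has no squares. -/
theorem bdryTree (hG : MedianGraph G) (hcf : CubeFree G) (H : Set V) {x y a c c' : V}
    (hxy : x ≠ y) (hx : x ∈ bdry G H x y) (ha : a ∈ bdry G H x y)
    (h1 : G.dist a c = 1) (h2 : G.dist x c + 1 = G.dist x a)
    (h1' : G.dist a c' = 1) (h2' : G.dist x c' + 1 = G.dist x a) : c = c' := by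
  by_contra hne
  obtain ⟨e, e1, e2, e3⟩ := exMed hG c c' x
  have n0 : G.dist c c' ≠ 0 := fun e => hne (d0 hG e)
  have adj : ∀ {a b}, G.dist a b = 1 → G.Adj a b := SimpleGraph.dist_eq_one_iff_adj.1
  have := cm (G := G) a c
  have := cm (G := G) a c'
  have := cm (G := G) e c
  have := cm (G := G) e c'
  have := cm (G := G) x c
  have := cm (G := G) x c'
  have := cm (G := G) x e
  have := cm (G := G) a e
  have := tr hG c a c'
  have := bip hG (adj h1') c
  have hc := bdryConv hG H hxy hx ha (m := c) (by omega)
  have hc' := bdryConv hG H hxy hx ha (m := c') (by omega)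
  have he := bdryConv hG H hxy hc hc' (m := e) (by omega)
  have := tr hG x e a
  have := tr hG e c a
  have ea : G.dist e a = 2 := by omega
  have ec : G.dist c e = 1 := by omega
  have ec' : G.dist c' e = 1 := by omega
  have cc : G.dist c c' = 2 := by omega
  obtain ⟨fa, ta, ya, ja⟩ := ha
  obtain ⟨fc, tc, yc, jc⟩ := hc
  obtain ⟨fc', tc', yc', jc'⟩ := hc'
  obtain ⟨fe, te, ye, je⟩ := he
  have m1 := fiberMatch hG H hxy fa ya ja fc yc jc
  have m2 := fiberMatch hG H hxy fa ya ja fc' yc' jc'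
  have m3 := fiberMatch hG H hxy fc yc jc fe ye je
  have m4 := fiberMatch hG H hxy fc' yc' jc' fe ye je
  have x1 := fiberAcross hG H hxy fa fe ye je
  have x2 := fiberAcross hG H hxy fe fa ya ja
  have x3 := fiberAcross hG H hxy fc fc' yc' jc'
  have x4 := fiberAcross hG H hxy fc' fc yc jc
  have := cm (G := G) c c'
  have y1 : ¬ G.dist a te ≤ 1 := by omega
  have y2 : ¬ G.dist e ta ≤ 1 := by omega
  have y3 : ¬ G.dist c tc' ≤ 1 := by omega
  have y4 : ¬ G.dist c' tc ≤ 1 := by omega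
  rw [h1] at m1
  rw [h1'] at m2
  rw [ec] at m3
  rw [ec'] at m4
  replace ja := SimpleGraph.dist_eq_one_iff_adj.2 ja
  replace jc := SimpleGraph.dist_eq_one_iff_adj.2 jc
  replace jc' := SimpleGraph.dist_eq_one_iff_adj.2 jc'
  replace je := SimpleGraph.dist_eq_one_iff_adj.2 je
  refine hcf (mkCube hG (fun p q r => bif p then (bif q then (bif r then a else c) else
      (bif r then c' else e)) else (bif q then (bif r then ta else tc) else (bif r then tc' else te)))
      ?_ ?_ ?_ ?_)
  · rintro (_ | _) (_ | _) <;> apply adj <;> simp only [cond_true, cond_false] <;> first | assumption | (rw [cm]; assumption)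
  · rintro (_ | _) (_ | _) <;> apply adj <;> simp only [cond_true, cond_false] <;> first | assumption | (rw [cm]; assumption)
  · rintro (_ | _) (_ | _) <;> apply adj <;> simp only [cond_true, cond_false] <;> first | assumption | (rw [cm]; assumption)
  · rintro (_ | _) (_ | _) (_ | _) <;> simp only [cond_true, cond_false, Bool.not_true, Bool.not_false] <;>
      first | assumption | (rw [cm]; assumption)

theorem noThree (hG : MedianGraph G) (hcf : CubeFree G) (H : Set V) (x : V) (hx : x ∈ H) (u : V)
    (a : Fin 3 → V) (hinj : Function.Injective a)
    (ha : ∀ i, a i ∈ imprints G u (totalBdry G H x)) : False := by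
  have hB : ∀ i, ∃ y, y ∈ H ∧ G.Adj x y ∧ a i ∈ bdry G H x y := by
    intro i
    have := (ha i).1
    simp only [totalBdry, Set.mem_iUnion] at this
    obtain ⟨y, ⟨hy, hxy⟩, h⟩ := this
    exact ⟨y, hy, hxy, h⟩
  have hself : ∀ y ∈ H, y ∈ fiber G H y := fun y hy => ⟨hy, fun w _ => by simp⟩
  have hxb : ∀ y, y ∈ H → G.Adj x y → x ∈ bdry G H x y := fun y hy hxy =>
    ⟨hself x hx, y, hself y hy, hxy⟩
  have himp : ∀ i w, w ∈ totalBdry G H x → G.dist u w + G.dist w (a i) = G.dist u (a i) →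
      w = a i := by
    intro i w hw h
    have : w ∈ gInterval G u (a i) ∩ totalBdry G H x := ⟨h, hw⟩
    rw [(ha i).2] at this
    exact this
  have hu : ∀ i, G.dist x (a i) + G.dist (a i) u = G.dist x u := by
    intro i
    obtain ⟨y, hy, hxy, hb⟩ := hB i
    obtain ⟨q, q1, q2, q3⟩ := exMed hG x (a i) u
    have hq := bdryConv hG H hxy.ne (hxb y hy hxy) hb q1
    have : q = a i := by
      apply himp i q
      · simp only [totalBdry, Set.mem_iUnion]
        exact ⟨y, ⟨hy, hxy⟩, hq⟩
      · rw [cm u q, cm q (a i), cm u (a i)]; omega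
    subst this
    rw [cm x (a i), cm (a i) u, cm x u]; omega
  refine hcf (threeIrr hG a hu ?_ ?_)
  · intro i j hij h
    have := himp i (a j) (ha j).1 (by
      have := hu i
      have := hu j
      rw [cm u (a j), cm (a j) (a i), cm u (a i)]; omega)
    exact hij (hinj this.symm)
  · intro i c c' h1 h2 h3 h4
    obtain ⟨y, hy, hxy, hb⟩ := hB i
    exact bdryTree hG hcf H hxy.ne (hxb y hy hxy) hb h1 h2 h3 h4

end QG

/-- In a cube-free median graph, the total boundary of any fiber of a star is
quasigated: every outside vertex has at most two imprints on it. -/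
theorem total_boundary_quasigated {V : Type*} (G : SimpleGraph V)
    (hG : MedianGraph G) (hcf : CubeFree G) (z x : V) (hx : x ∈ gStar G z)
    (u : V) (hu : u ∉ totalBdry G (gStar G z) x) :
    ∃ a b : V, imprints G u (totalBdry G (gStar G z) x) ⊆ {a, b} := by
  by_contra hcon
  push Not at hcon
  obtain ⟨a, ha, -⟩ := Set.not_subset.1 (hcon x x)
  obtain ⟨b, hb, hab⟩ := Set.not_subset.1 (hcon a a)
  obtain ⟨c, hc, hc'⟩ := Set.not_subset.1 (hcon a b)
  simp only [Set.mem_insert_iff, Set.mem_singleton_iff, not_or] at hab hc'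
  refine QG.noThree hG hcf (gStar G z) x hx u ![a, b, c] ?_ ?_
  · intro i j hij
    fin_cases i <;> fin_cases j <;> simp_all
  · intro i
    fin_cases i <;> simpa
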